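/- arXiv:1811.10140 — 3 statements merged into one kernel-verified Lean document; each statement's English description precedes it below -/
import Mathlib

section
/- Let 𝒜 = {M_i} be a channel on H and X ∈ B(H). (i) If X is measurable with respect to 𝒜 (i.e. X commutes with every branch M_i), then L_𝒜(X) = X. (ii) Conversely, if 𝒜 is a sharp channel and L_𝒜(X) = X, then X is measurable with respect to 𝒜. -/
/-- Orthogonal projections that sum strongly to the identity are pairwise orthogonal. -/
theorem apply_apply_eq_zero_of_hasSum_projections {𝕜 H ι : Type*} [RCLike 𝕜]
    [NormedAddCommGroup H] [InnerProductSpace 𝕜 H] [CompleteSpace H] {P : ι → H →L[𝕜] H}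
    (hsa : ∀ i, IsSelfAdjoint (P i)) (hid : ∀ i, IsIdempotentElem (P i))
    (hsum : ∀ x, HasSum (fun i => P i x) x) {i j : ι} (hij : i ≠ j) (x : H) :
    P i (P j x) = 0 := by
  classical
  have idem (k : ι) (z : H) : P k (P k z) = P k z := DFunLike.congr_fun (hid k) z
  have hnorm (k : ι) (y : H) : RCLike.re (inner 𝕜 y (P k y)) = ‖P k y‖ ^ 2 := by
    rw [← idem k y, ← ContinuousLinearMap.adjoint_inner_left, (hsa k).adjoint_eq, idem,
      inner_self_eq_norm_sq]
  have hs : HasSum (fun k => ‖P k (P j x)‖ ^ 2) (‖P j x‖ ^ 2) := by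
    have h := RCLike.reCLM.hasSum ((innerSL 𝕜 (P j x)).hasSum (hsum (P j x)))
    simpa only [Function.comp_def, RCLike.reCLM_apply, innerSL_apply_apply, hnorm,
      inner_self_eq_norm_sq] using h
  have hle := sum_le_hasSum {i, j} (fun k _ => sq_nonneg ‖P k (P j x)‖) hs
  rw [Finset.sum_pair hij, idem] at hle
  exact norm_eq_zero.1 (pow_eq_zero_iff two_ne_zero |>.1 (le_antisymm (by linarith) (sq_nonneg _)))

/-- The channel map condition: `L X` is the SOT-convergent sum `∑ i, (M i)* X (M i)`,
expressed pointwise. -/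
theorem stmt_0 {H : Type*} [NormedAddCommGroup H] [InnerProductSpace ℂ H] [CompleteSpace H]
    [TopologicalSpace.SeparableSpace H] {ι : Type*} [Countable ι]
    -- 𝒜 = {M i} is a channel:
    (M : ι → H →L[ℂ] H) (hM0 : ∀ i, M i ≠ 0)
    (hM1 : ∀ x : H, HasSum (fun i => ContinuousLinearMap.adjoint (M i) (M i x)) x)
    (hM2 : ∀ x : H, HasSum (fun i => M i (ContinuousLinearMap.adjoint (M i) x)) x)
    -- LA is the channel map of 𝒜:
    (LA : (H →L[ℂ] H) → (H →L[ℂ] H))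
    (hLA : ∀ (Y : H →L[ℂ] H) (x : H),
      HasSum (fun i => ContinuousLinearMap.adjoint (M i) (Y (M i x))) (LA Y x))
    (X : H →L[ℂ] H) :
    -- (i) if X is measurable with respect to 𝒜 then L_𝒜(X) = X;
    ((∀ i, X * M i = M i * X) → LA X = X) ∧
    -- (ii) if 𝒜 is sharp and L_𝒜(X) = X then X is measurable with respect to 𝒜.
    ((∀ i, IsSelfAdjoint (M i) ∧ IsIdempotentElem (M i)) → LA X = X →
      ∀ i, X * M i = M i * X) := by
  refine ⟨fun hX => ?_, fun hsharp hfix j => ?_⟩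
  · ext x
    refine (hLA X x).unique ?_
    have hcomm (i : ι) : X (M i x) = M i (X x) := DFunLike.congr_fun (hX i) x
    simpa only [hcomm] using hM1 (X x)
  · have idem (i : ι) (z : H) : M i (M i z) = M i z := DFunLike.congr_fun (hsharp i).2 z
    simp only [(hsharp _).1.adjoint_eq] at hM1 hLA
    have orth {i k : ι} (hik : i ≠ k) (z : H) : M i (M k z) = 0 :=
      apply_apply_eq_zero_of_hasSum_projections (fun i => (hsharp i).1) (fun i => (hsharp i).2)
        (fun z => by simpa only [idem] using hM1 z) hik z
    have hL (x : H) : HasSum (fun i => M i (X (M i x))) (X x) := by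
      simpa only [hfix] using hLA X x
    ext x
    have hright : X (M j x) = M j (X (M j x)) := by
      refine (hL (M j x)).unique ?_
      convert hasSum_single j (fun i hi => ?_) using 1
      · rw [idem]
      · rw [orth hi, map_zero, map_zero]
    have hleft : M j (X x) = M j (X (M j x)) := by
      refine ((M j).hasSum (hL x)).unique ?_
      convert hasSum_single j (fun i hi => ?_) using 1
      · exact (idem j _).symm
      · exact orth hi.symm _
    exact hright.trans hleft.symm
end

section
/- Let 𝒜 be a sharp channel on H. Then 𝒜 is a context if and only if L_𝒜(P) L_𝒜(Q) = L_𝒜(Q) L_𝒜(P) for every pair of rank-one orthogonal projections P, Q on H. -/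
/-- The rank-one projection `|φ⟩⟨φ|`. -/
noncomputable def rankOne {H : Type*} [NormedAddCommGroup H] [InnerProductSpace ℂ H] (φ : H) :
    H →L[ℂ] H := (innerSL ℂ φ).smulRight φ

theorem rankOne_apply {H : Type*} [NormedAddCommGroup H] [InnerProductSpace ℂ H] (φ x : H) :
    rankOne φ x = inner ℂ φ x • φ := rfl

/-- A branch of a sharp channel compresses the value of the channel map to the corresponding
diagonal block. -/
theorem branch_apply_channelMap {H : Type*} [NormedAddCommGroup H] [InnerProductSpace ℂ H]
    {ι : Type*} {P : ι → H →L[ℂ] H} (hidem : ∀ i, IsIdempotentElem (P i))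
    (horth : ∀ i j, i ≠ j → P i * P j = 0) {Y L : H →L[ℂ] H}
    (hL : ∀ x, HasSum (fun i => P i (Y (P i x))) (L x)) (j : ι) (x : H) :
    P j (L x) = P j (Y (P j x)) := by
  have h₁ := (hL x).mapL (P j)
  have h₂ := hasSum_single (f := fun i => P j (P i (Y (P i x)))) j fun i hi => by
    simpa using DFunLike.congr_fun (horth j i hi.symm) (Y (P i x))
  rw [h₁.unique h₂]
  simpa using DFunLike.congr_fun (hidem j).eq (Y (P j x))

/-- If `φ` is a unit vector and the rank-one projections onto the lines spanned by `φ` and `z`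
commute at `φ`, where `z - φ` is orthogonal to `φ`, then `z = φ`. -/
theorem eq_of_rankOne_commute {H : Type*} [NormedAddCommGroup H] [InnerProductSpace ℂ H]
    {φ z : H} {c : ℂ} (hc : c ≠ 0) (hφ : ‖φ‖ = 1) (hz : inner ℂ φ z = 1)
    (h : rankOne φ (rankOne (c • z) φ) = rankOne (c • z) (rankOne φ φ)) : z = φ := by
  have hz' : inner ℂ z φ = 1 := by rw [← inner_conj_symm, hz, map_one]
  simp only [rankOne_apply, inner_smul_left, inner_smul_right, hz, hz',
    inner_self_eq_norm_sq_to_K, hφ, smul_smul] at h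
  have hcc : (starRingEnd ℂ) c * c ≠ 0 := mul_ne_zero (by simpa using hc) hc
  exact (smul_right_injective H hcc (by simpa using h)).symm

theorem stmt_2 {H : Type*} [NormedAddCommGroup H] [InnerProductSpace ℂ H] [CompleteSpace H]
    [TopologicalSpace.SeparableSpace H] {ι : Type*} [Countable ι]
    -- 𝒜 = {P i} is a sharp channel:
    (P : ι → H →L[ℂ] H)
    (hsa : ∀ i, IsSelfAdjoint (P i)) (hidem : ∀ i, IsIdempotentElem (P i))
    (h0 : ∀ i, P i ≠ 0) (horth : ∀ i j, i ≠ j → P i * P j = 0)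
    (htotal : ∀ x : H, HasSum (fun i => P i x) x)
    -- LA is the channel map of 𝒜:
    (LA : (H →L[ℂ] H) → (H →L[ℂ] H))
    (hLA : ∀ (Y : H →L[ℂ] H) (x : H), HasSum (fun i => P i (Y (P i x))) (LA Y x)) :
    -- 𝒜 is a context (each branch is a rank-one projection) iff
    -- L_𝒜(P)L_𝒜(Q) = L_𝒜(Q)L_𝒜(P) for all rank-one projections P, Q:
    (∀ i, ∃ φ : H, ‖φ‖ = 1 ∧ P i = rankOne φ) ↔
      (∀ φ ψ : H, ‖φ‖ = 1 → ‖ψ‖ = 1 →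
        LA (rankOne φ) * LA (rankOne ψ) = LA (rankOne ψ) * LA (rankOne φ)) := by
  have hkey := fun Y => branch_apply_channelMap hidem horth (hLA Y)
  constructor
  · intro hctx φ ψ _ _
    ext x
    suffices h : ∀ j, P j ((LA (rankOne φ) * LA (rankOne ψ)) x) =
        P j ((LA (rankOne ψ) * LA (rankOne φ)) x) from
      (htotal _).unique (by simpa only [h] using htotal ((LA (rankOne ψ) * LA (rankOne φ)) x))
    intro j
    obtain ⟨χ, -, hχ⟩ := hctx j
    simp only [mul_apply_eq_comp, hkey]
    simp only [hχ, rankOne_apply, map_smul, smul_smul]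
    congr 1
    ring
  · intro hcomm i
    have hPP : ∀ x, P i (P i x) = P i x := fun x => DFunLike.congr_fun (hidem i).eq x
    obtain ⟨v, hv⟩ : ∃ v, P i v ≠ 0 := by
      by_contra! hall
      exact h0 i (ContinuousLinearMap.ext hall)
    set φ : H := ((‖P i v‖ : ℂ)⁻¹) • P i v with hφdef
    have hφ : ‖φ‖ = 1 := norm_smul_inv_norm hv
    have hPφ : P i φ = φ := by rw [hφdef, map_smul, hPP]
    refine ⟨φ, hφ, ContinuousLinearMap.ext fun x => ?_⟩
    set z : H := φ + (P i x - inner ℂ φ x • φ) with hzdef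
    have hPz : P i z = z := by simp [hzdef, hPφ, hPP]
    have hinner : inner ℂ φ (P i x) = inner ℂ φ x := by
      have := (hsa i).isSymmetric φ x
      simp only [ContinuousLinearMap.coe_coe, hPφ] at this
      exact this.symm
    have hz : inner ℂ φ z = 1 := by
      simp [hzdef, hφ, hinner]
    have hz0 : z ≠ 0 := by
      rintro h
      simp [h] at hz
    have hc : (‖z‖ : ℂ)⁻¹ ≠ 0 := by simpa using hz0
    have h := congrArg (fun T : H →L[ℂ] H => P i (T φ))
      (hcomm φ ((‖z‖ : ℂ)⁻¹ • z) hφ (norm_smul_inv_norm hz0))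
    simp only [mul_apply_eq_comp, hkey] at h
    have hzφ : z = φ := by
      refine eq_of_rankOne_commute hc hφ hz ?_
      simpa only [rankOne_apply, map_smul, hPφ, hPz] using h
    rw [rankOne_apply, ← sub_eq_zero]
    simpa [hzdef] using hzφ
end

section
/- Let 𝒜 and ℬ be sharp channels on H. Then the product channels satisfy 𝒜ℬ = ℬ𝒜 (i.e. {PQ : P ∈ 𝒜, Q ∈ ℬ, PQ ≠ 0} = {QP : Q ∈ ℬ, P ∈ 𝒜, QP ≠ 0}) if and only if PQ = QP for every P ∈ 𝒜 and Q ∈ ℬ. -/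
variable {H : Type*} [NormedAddCommGroup H] [InnerProductSpace ℂ H] [CompleteSpace H]

/-- A sharp channel: a family of pairwise orthogonal nonzero orthogonal projections
summing to `I` in the strong operator topology. -/
def IsSharpChannel (S : Set (H →L[ℂ] H)) : Prop :=
  (∀ P ∈ S, IsSelfAdjoint P ∧ IsIdempotentElem P ∧ P ≠ 0) ∧
  (∀ P ∈ S, ∀ Q ∈ S, P ≠ Q → P * Q = 0) ∧
  (∀ x : H, HasSum (fun P : S => (P : H →L[ℂ] H) x) x)

/-- The product channel 𝒜ℬ = {PQ : P ∈ 𝒜, Q ∈ ℬ}, discarding zero products. -/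
def prodChannel (A B : Set (H →L[ℂ] H)) : Set (H →L[ℂ] H) :=
  {R | R ≠ 0 ∧ ∃ P ∈ A, ∃ Q ∈ B, R = P * Q}

/-- If `P * Q * P = 0` for self-adjoint `P` and a self-adjoint idempotent `Q`, then `P * Q = 0`. -/
theorem mul_eq_zero_of_mul_mul_self_eq_zero {R : Type*} [NonUnitalNormedRing R] [StarRing R]
    [CStarRing R] {P Q : R} (hP : IsSelfAdjoint P) (hQ : IsSelfAdjoint Q)
    (hQi : IsIdempotentElem Q) (h : P * Q * P = 0) : P * Q = 0 := by
  rw [← CStarRing.mul_star_self_eq_zero_iff, star_mul, hP.star_eq, hQ.star_eq, ← mul_assoc,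
    mul_assoc P Q Q, hQi.eq, h]

/-- Two self-adjoint elements with zero product have zero product in the other order. -/
theorem IsSelfAdjoint.mul_eq_zero_symm {R : Type*} [NonUnitalSemiring R] [StarRing R] {P Q : R}
    (hP : IsSelfAdjoint P) (hQ : IsSelfAdjoint Q) (h : P * Q = 0) : Q * P = 0 := by
  simpa [hP.star_eq, hQ.star_eq] using congrArg star h

/-- For commuting families, one product channel is contained in the other. -/
theorem prodChannel_subset_of_commute {E : Type*} [NormedAddCommGroup E] [InnerProductSpace ℂ E]
    {A B : Set (E →L[ℂ] E)}
    (h : ∀ P ∈ A, ∀ Q ∈ B, P * Q = Q * P) : prodChannel A B ⊆ prodChannel B A := by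
  rintro R ⟨hR, P, hP, Q, hQ, rfl⟩
  exact ⟨hR, Q, hQ, P, hP, h P hP Q hQ⟩

theorem stmt_5 [TopologicalSpace.SeparableSpace H] (A B : Set (H →L[ℂ] H))
    (hA : IsSharpChannel A) (hB : IsSharpChannel B) :
    prodChannel A B = prodChannel B A ↔ ∀ P ∈ A, ∀ Q ∈ B, P * Q = Q * P := by
  refine ⟨fun h P hP Q hQ => ?_, fun h => (prodChannel_subset_of_commute h).antisymm
    (prodChannel_subset_of_commute fun Q hQ P hP => (h P hP Q hQ).symm)⟩
  obtain ⟨hPs, hPi, -⟩ := hA.1 P hP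
  obtain ⟨hQs, hQi, -⟩ := hB.1 Q hQ
  by_cases h0 : P * Q = 0
  · rw [h0, hPs.mul_eq_zero_symm hQs h0]
  have hmem : P * Q ∈ prodChannel B A := h ▸ ⟨h0, P, hP, Q, hQ, rfl⟩
  obtain ⟨-, Q', hQ', P', hP', e⟩ := hmem
  have hPP' : P' = P := by
    by_contra hne
    refine h0 (mul_eq_zero_of_mul_mul_self_eq_zero hPs hQs hQi ?_)
    rw [e, mul_assoc, hA.2.1 P' hP' P hP hne, mul_zero]
  have hQQ' : Q = Q' := by
    by_contra hne
    refine h0 (hQs.mul_eq_zero_symm hPs (mul_eq_zero_of_mul_mul_self_eq_zero hQs hPs hPi ?_))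
    rw [mul_assoc, e, ← mul_assoc, hB.2.1 Q hQ Q' hQ' hne, zero_mul]
  rw [e, hPP', ← hQQ']
end
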